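/- arXiv:2008.06349 — 3 statements merged into one kernel-verified Lean document; each statement's English description precedes it below -/
import Mathlib

section
/- The function τ₀(t) = ( t[(1−t)log((1−t)/t) − 1]² + π² t (1−t)² )^{−1} is convex on (0,1), satisfies lim_{t→0⁺} τ₀(t) = ∞ and lim_{t→1⁻} τ₀(t) = 1, and has a unique minimum point in (0,1). -/
/-- The density `τ₀(t) = ( t[(1−t)log((1−t)/t) − 1]² + π² t (1−t)² )⁻¹` for `0 < t < 1`. -/
noncomputable def tau0 (t : ℝ) : ℝ :=
  (t * ((1 - t) * Real.log ((1 - t) / t) - 1) ^ 2 + Real.pi ^ 2 * t * (1 - t) ^ 2)⁻¹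

open Real Set Filter Topology

/-- The squared modulus `((1 - t) log ((1 - t) / t) - 1)² + π² (1 - t)²`. -/
noncomputable def tau0Modulus (t : ℝ) : ℝ :=
  ((1 - t) * log ((1 - t) / t) - 1) ^ 2 + π ^ 2 * (1 - t) ^ 2

/-- The derivative of `tau0Modulus` on `(0,1)`. -/
noncomputable def tau0ModulusDeriv (t : ℝ) : ℝ :=
  2 * ((1 - t) * log ((1 - t) / t) - 1) * (-log ((1 - t) / t) - 1 / t) - 2 * π ^ 2 * (1 - t)

theorem tau0_eq_inv_mul_tau0Modulus : tau0 = fun t => (t * tau0Modulus t)⁻¹ := by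
  funext t
  unfold tau0 tau0Modulus
  congr 1
  ring

theorem tau0Modulus_pos {t : ℝ} (ht : t ∈ Ioo (0 : ℝ) 1) : 0 < tau0Modulus t := by
  have hs : 0 < 1 - t := sub_pos.2 ht.2
  unfold tau0Modulus
  positivity

theorem hasDerivAt_log_one_sub_div_self {t : ℝ} (ht : t ∈ Ioo (0 : ℝ) 1) :
    HasDerivAt (fun x => log ((1 - x) / x)) (-1 / (t * (1 - t))) t := by
  have h0 : t ≠ 0 := ht.1.ne'
  have h1 : 1 - t ≠ 0 := (sub_pos.2 ht.2).ne'
  have h := ((((hasDerivAt_id t).const_sub 1).div (hasDerivAt_id t) h0)).log (div_ne_zero h1 h0)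
  refine h.congr_deriv ?_
  simp only [id, Pi.div_apply]
  field_simp
  ring

theorem hasDerivAt_tau0Modulus {t : ℝ} (ht : t ∈ Ioo (0 : ℝ) 1) :
    HasDerivAt tau0Modulus (tau0ModulusDeriv t) t := by
  have h0 : t ≠ 0 := ht.1.ne'
  have h1 : 1 - t ≠ 0 := (sub_pos.2 ht.2).ne'
  have hs := (hasDerivAt_id t).const_sub 1
  have h := (((hs.mul (hasDerivAt_log_one_sub_div_self ht)).sub_const 1).pow 2).add
    ((hs.pow 2).const_mul (π ^ 2))
  refine h.congr_deriv ?_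
  simp only [id, Pi.mul_apply, tau0ModulusDeriv]
  field_simp
  ring

theorem hasDerivAt_tau0ModulusDeriv {t : ℝ} (ht : t ∈ Ioo (0 : ℝ) 1) :
    HasDerivAt tau0ModulusDeriv
      (2 * (-log ((1 - t) / t) - 1 / t) ^ 2
        + 2 * ((1 - t) * log ((1 - t) / t) - 1) * (1 / (t ^ 2 * (1 - t))) + 2 * π ^ 2) t := by
  have h0 : t ≠ 0 := ht.1.ne'
  have h1 : 1 - t ≠ 0 := (sub_pos.2 ht.2).ne'
  have hs := (hasDerivAt_id t).const_sub 1
  have hl := hasDerivAt_log_one_sub_div_self ht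
  have h := ((((hs.mul hl).sub_const 1).const_mul 2).mul
    (hl.neg.sub ((hasDerivAt_const t (1 : ℝ)).div (hasDerivAt_id t) h0))).sub
    (hs.const_mul (2 * π ^ 2))
  refine h.congr_deriv ?_
  simp only [id, Pi.mul_apply, Pi.neg_apply, Pi.sub_apply, Pi.div_apply]
  field_simp
  ring

theorem hasDerivAt_tau0 {t : ℝ} (ht : t ∈ Ioo (0 : ℝ) 1) :
    HasDerivAt tau0
      (-(tau0Modulus t + t * tau0ModulusDeriv t) / (t * tau0Modulus t) ^ 2) t := by
  rw [tau0_eq_inv_mul_tau0Modulus]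
  have h := ((hasDerivAt_id t).mul (hasDerivAt_tau0Modulus ht)).inv
    (mul_ne_zero ht.1.ne' (tau0Modulus_pos ht).ne')
  refine h.congr_deriv ?_
  simp

theorem pi_sq_mul_lt_of_sq_bounds {s Q x : ℝ} (hs0 : 0 < s) (hs1 : s < 1)
    (hx : x * (1 - s) ≤ s * (2 * s - 1)) (hQ : Q = (x - 1) ^ 2 + π ^ 2 * s ^ 2) :
    π ^ 2 * s < Q ^ 2 * (1 - 3 / 4 * s) := by
  have hp1 : 9.85 < π ^ 2 := by nlinarith [pi_gt_d4]
  have hp2 : π ^ 2 < 9.88 := by nlinarith [pi_lt_d4, pi_pos]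
  set p := π ^ 2
  rcases le_or_gt s (1 / 2) with h | h
  · have hx' : x ≤ s * (2 * s - 1) := by nlinarith
    have hQ' : 1 + 2 * s + 5.85 * s ^ 2 ≤ Q := by
      rw [hQ]; nlinarith [sq_nonneg x, sq_nonneg s]
    have hQ2 : (1 + 2 * s + 5.85 * s ^ 2) ^ 2 ≤ Q ^ 2 := by
      apply pow_le_pow_left₀ (by positivity) hQ'
    have key : 9.88 * s < (1 + 2 * s + 5.85 * s ^ 2) ^ 2 * (1 - 3 / 4 * s) := by
      have hsq : 3.268 * (1 + 2 * s + 5.85 * s ^ 2) - 2.67 ≤ (1 + 2 * s + 5.85 * s ^ 2) ^ 2 := by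
        nlinarith [sq_nonneg (1 + 2 * s + 5.85 * s ^ 2 - 1.634)]
      have hcube : s ^ 3 ≤ s ^ 2 / 2 := by nlinarith [sq_nonneg s]
      nlinarith [mul_le_mul_of_nonneg_right hsq (by linarith : (0:ℝ) ≤ 1 - 3 / 4 * s),
        sq_nonneg (s - 0.27)]
    nlinarith [mul_le_mul_of_nonneg_right hQ2 (by linarith : (0:ℝ) ≤ 1 - 3 / 4 * s)]
  rcases le_or_gt s (3 / 5) with h' | h'
  · have hx' : x ≤ 5 / 2 * (s * (2 * s - 1)) := by
      nlinarith [mul_pos hs0 (by linarith : (0:ℝ) < 2 * s - 1)]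
    have hQ' : 3.4 ≤ Q := by
      rw [hQ]; nlinarith [sq_nonneg x, mul_pos hs0 hs0]
    nlinarith [mul_self_le_mul_self (by norm_num) hQ']
  · have hQ' : p * s ^ 2 ≤ Q := by rw [hQ]; nlinarith [sq_nonneg (x - 1)]
    have hQ2 : (p * s ^ 2) ^ 2 ≤ Q ^ 2 := by
      apply pow_le_pow_left₀ (by positivity) hQ'
    have hc : 1 / 9.85 < s ^ 3 * (1 - 3 / 4 * s) := by
      nlinarith [mul_pos (sub_pos.2 h') (sub_pos.2 hs1), pow_pos hs0 2, pow_pos hs0 3,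
        mul_pos (mul_pos (sub_pos.2 h') (sub_pos.2 hs1)) hs0,
        mul_pos (mul_pos (sub_pos.2 h') (sub_pos.2 hs1)) (mul_pos hs0 hs0)]
    have hps : 0 < p * s := by positivity
    have hc' : 1 < p * (s ^ 3 * (1 - 3 / 4 * s)) := by nlinarith
    calc p * s < p * s * (p * (s ^ 3 * (1 - 3 / 4 * s))) := lt_mul_of_one_lt_right hps hc'
      _ = (p * s ^ 2) ^ 2 * (1 - 3 / 4 * s) := by ring
      _ ≤ _ := mul_le_mul_of_nonneg_right hQ2 (by linarith)

theorem pi_sq_mul_one_sub_lt {t : ℝ} (ht : t ∈ Ioo (0 : ℝ) 1) :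
    π ^ 2 * (1 - t) < tau0Modulus t ^ 2 * (1 - 3 / 4 * (1 - t)) := by
  have hs : 0 < 1 - t := sub_pos.2 ht.2
  refine pi_sq_mul_lt_of_sq_bounds (x := (1 - t) * log ((1 - t) / t)) hs (by linarith [ht.1]) ?_ rfl
  have hl := log_le_sub_one_of_pos (div_pos hs ht.1)
  have hl' : log ((1 - t) / t) * t ≤ 1 - 2 * t := by
    calc log ((1 - t) / t) * t ≤ ((1 - t) / t - 1) * t := mul_le_mul_of_nonneg_right hl ht.1.le
      _ = 1 - 2 * t := by field_simp [ht.1.ne']; ring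
  nlinarith

theorem deriv2_tau0_pos {t : ℝ} (ht : t ∈ Ioo (0 : ℝ) 1) : 0 < deriv^[2] tau0 t := by
  have h0 : t ≠ 0 := ht.1.ne'
  have hs : 0 < 1 - t := sub_pos.2 ht.2
  have h1 : 1 - t ≠ 0 := hs.ne'
  have hQ := tau0Modulus_pos ht
  have hev : deriv tau0 =ᶠ[𝓝 t]
      fun x => -(tau0Modulus x + x * tau0ModulusDeriv x) / (x * tau0Modulus x) ^ 2 := by
    filter_upwards [isOpen_Ioo.mem_nhds ht] with x hx using (hasDerivAt_tau0 hx).deriv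
  have hmod := hasDerivAt_tau0Modulus ht
  have h := ((hmod.add ((hasDerivAt_id t).mul (hasDerivAt_tau0ModulusDeriv ht))).neg).div
    (((hasDerivAt_id t).mul hmod).pow 2) (pow_ne_zero 2 (mul_ne_zero h0 hQ.ne'))
  have hd := (h.congr_of_eventuallyEq hev).deriv
  simp only [Function.iterate_succ, Function.iterate_zero, Function.comp, id]
  rw [hd]
  have hb := pi_sq_mul_one_sub_lt ht
  set Q := tau0Modulus t with hQdef
  set A := (1 - t) * log ((1 - t) / t) - 1 with hA
  have hL : log ((1 - t) / t) = (A + 1) / (1 - t) := by rw [hA]; field_simp; ring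
  have hQA : A ^ 2 = Q - π ^ 2 * (1 - t) ^ 2 := by rw [hQdef, tau0Modulus, ← hA]; ring
  have hD : (1 - t) * t * tau0ModulusDeriv t = -2 * t * Q - 2 * A := by
    rw [tau0ModulusDeriv, ← hA, hL]
    field_simp
    linear_combination (-t) * hQA
  have hD' : tau0ModulusDeriv t = (-2 * t * Q - 2 * A) / ((1 - t) * t) := by
    rw [← hD]; field_simp
  have key : 0 < 2 / ((1 - t) ^ 2 * t ^ 3 * Q ^ 3) *
      (3 * (t * Q + A) * (t * Q + A - (1 - t) * Q) + (1 - t) * Q ^ 2 - π ^ 2 * (1 - t) ^ 2) := by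
    apply mul_pos
    · have := ht.1
      positivity
    · nlinarith [sq_nonneg (2 * (t * Q + A) - (1 - t) * Q), mul_lt_mul_of_pos_left hb hs]
  convert key using 1
  simp only [id, Pi.mul_apply, Pi.add_apply, Pi.neg_apply, Pi.pow_apply, ← hQdef]
  rw [hD', hL]
  have hQ0 := hQ.ne'
  have hpi : π ^ 2 = (Q - A ^ 2) / (1 - t) ^ 2 := by rw [hQA]; field_simp; ring
  rw [hpi]
  clear_value Q A
  field_simp
  ring

theorem continuousOn_tau0Modulus : ContinuousOn tau0Modulus (Ioo 0 1) :=
  fun _ ht => (hasDerivAt_tau0Modulus ht).continuousAt.continuousWithinAt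

theorem strictConvexOn_tau0 : StrictConvexOn ℝ (Ioo 0 1) tau0 := by
  refine strictConvexOn_of_deriv2_pos (convex_Ioo 0 1)
    (fun _ ht => (hasDerivAt_tau0 ht).continuousAt.continuousWithinAt) fun t ht => ?_
  rw [interior_Ioo] at ht
  exact deriv2_tau0_pos ht

theorem tendsto_mul_tau0Modulus_zero :
    Tendsto (fun t => t * tau0Modulus t) (𝓝[Ioo 0 1] 0) (𝓝 0) := by
  have hlog : Tendsto (fun t : ℝ => log t * t ^ (1 / 2 : ℝ)) (𝓝[Ioo 0 1] 0) (𝓝 0) :=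
    (tendsto_log_mul_rpow_nhdsGT_zero (by norm_num)).mono_left
      (nhdsWithin_mono _ Ioo_subset_Ioi_self)
  have hsqrt : Tendsto (fun t : ℝ => √t * ((1 - t) * log (1 - t) - 1)) (𝓝[Ioo 0 1] 0) (𝓝 0) := by
    have : Continuous fun t : ℝ => √t * ((1 - t) * log (1 - t) - 1) :=
      continuous_sqrt.mul ((continuous_mul_log.comp (continuous_const.sub continuous_id)).sub
        continuous_const)
    simpa using (this.tendsto 0).mono_left nhdsWithin_le_nhds
  have hone : Tendsto (fun t : ℝ => 1 - t) (𝓝[Ioo 0 1] 0) (𝓝 1) := by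
    have : Continuous fun t : ℝ => 1 - t := by fun_prop
    simpa using (this.tendsto 0).mono_left nhdsWithin_le_nhds
  have hpoly : Tendsto (fun t : ℝ => π ^ 2 * t * (1 - t) ^ 2) (𝓝[Ioo 0 1] 0) (𝓝 0) := by
    have : Continuous fun t : ℝ => π ^ 2 * t * (1 - t) ^ 2 := by fun_prop
    simpa using (this.tendsto 0).mono_left nhdsWithin_le_nhds
  have h := ((hsqrt.sub (hone.mul hlog)).pow 2).add hpoly
  simp only [mul_zero, sub_zero, ne_eq, OfNat.ofNat_ne_zero, not_false_eq_true, zero_pow,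
    add_zero] at h
  refine h.congr' ?_
  filter_upwards [self_mem_nhdsWithin] with t ht
  have hs : 1 - t ≠ 0 := (sub_pos.2 ht.2).ne'
  rw [tau0Modulus, log_div hs ht.1.ne', ← sqrt_eq_rpow]
  linear_combination (((1 - t) * (log (1 - t) - log t) - 1) ^ 2) * sq_sqrt ht.1.le

theorem tendsto_mul_tau0Modulus_one :
    Tendsto (fun t => t * tau0Modulus t) (𝓝[Ioo 0 1] 1) (𝓝 1) := by
  have hlog : Tendsto (fun t : ℝ => (1 - t) * log (1 - t)) (𝓝 1) (𝓝 0) := by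
    have : Continuous fun t : ℝ => (1 - t) * log (1 - t) :=
      continuous_mul_log.comp (continuous_const.sub continuous_id)
    simpa using this.tendsto 1
  have hlog' : Tendsto (fun t : ℝ => (1 - t) * log t) (𝓝 1) (𝓝 0) := by
    have : ContinuousAt (fun t : ℝ => (1 - t) * log t) 1 :=
      (continuousAt_const.sub continuousAt_id).mul (continuousAt_log one_ne_zero)
    simpa using this.tendsto
  have hpoly : Tendsto (fun t : ℝ => π ^ 2 * (1 - t) ^ 2) (𝓝 1) (𝓝 0) := by
    have : Continuous fun t : ℝ => π ^ 2 * (1 - t) ^ 2 := by fun_prop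
    simpa using this.tendsto 1
  have h := (tendsto_id (x := 𝓝 (1 : ℝ))).mul
    ((((hlog.sub hlog').sub_const 1).pow 2).add hpoly)
  norm_num at h
  refine (h.mono_left nhdsWithin_le_nhds).congr' ?_
  filter_upwards [self_mem_nhdsWithin] with t ht
  rw [tau0Modulus, log_div (sub_pos.2 ht.2).ne' ht.1.ne']
  ring

theorem one_lt_half_mul_tau0Modulus_half : 1 < (1 / 2 : ℝ) * tau0Modulus (1 / 2) := by
  rw [tau0Modulus]
  norm_num
  nlinarith [pi_gt_three]

theorem exists_forall_mul_tau0Modulus_le :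
    ∃ t ∈ Ioo (0 : ℝ) 1, ∀ s ∈ Ioo (0 : ℝ) 1, s * tau0Modulus s ≤ t * tau0Modulus t := by
  set g : ℝ → ℝ := fun t => t * tau0Modulus t with hg
  have hcont : ContinuousOn g (Ioo 0 1) := continuousOn_id.mul continuousOn_tau0Modulus
  have h0 : Tendsto g (𝓝[>] 0) (𝓝 0) := by
    rw [← nhdsWithin_Ioo_eq_nhdsGT zero_lt_one]; exact tendsto_mul_tau0Modulus_zero
  have h1 : Tendsto g (𝓝[<] 1) (𝓝 1) := by
    rw [← nhdsWithin_Ioo_eq_nhdsLT zero_lt_one]; exact tendsto_mul_tau0Modulus_one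
  have hext := continuousOn_Icc_extendFrom_Ioo hcont h0 h1
  have hin : ∀ s ∈ Ioo (0 : ℝ) 1, extendFrom (Ioo 0 1) g s = g s := fun s hs =>
    extendFrom_eq (subset_closure hs) (hcont s hs)
  have hhalf : (1 / 2 : ℝ) ∈ Ioo (0 : ℝ) 1 := by norm_num
  obtain ⟨t, ht, hmax⟩ := isCompact_Icc.exists_isMaxOn ⟨_, Ioo_subset_Icc_self hhalf⟩ hext
  have hlt : 1 < extendFrom (Ioo 0 1) g t :=
    (one_lt_half_mul_tau0Modulus_half.trans_eq (hin _ hhalf).symm).trans_le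
      (hmax (Ioo_subset_Icc_self hhalf))
  have ht0 : t ≠ 0 := by
    rintro rfl
    rw [eq_lim_at_left_extendFrom_Ioo zero_lt_one h0] at hlt
    exact absurd hlt (by norm_num)
  have ht1 : t ≠ 1 := by
    rintro rfl
    rw [eq_lim_at_right_extendFrom_Ioo zero_lt_one h1] at hlt
    exact absurd hlt (by norm_num)
  have ht' : t ∈ Ioo (0 : ℝ) 1 := ⟨ht.1.lt_of_ne' ht0, ht.2.lt_of_ne ht1⟩
  refine ⟨t, ht', fun s hs => ?_⟩
  have := hmax (Ioo_subset_Icc_self hs)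
  rwa [mem_ofPred_eq, hin s hs, hin t ht'] at this

/-- `τ₀` is convex on `(0,1)`, tends to `∞` at `0⁺` and to `1` at `1⁻`, and has a unique
minimum point in `(0,1)`. -/
theorem tau0_convex_limits_unique_min :
    ConvexOn ℝ (Set.Ioo (0 : ℝ) 1) tau0 ∧
    Filter.Tendsto tau0 (nhdsWithin 0 (Set.Ioo (0 : ℝ) 1)) Filter.atTop ∧
    Filter.Tendsto tau0 (nhdsWithin 1 (Set.Ioo (0 : ℝ) 1)) (nhds 1) ∧
    ∃! t : ℝ, t ∈ Set.Ioo (0 : ℝ) 1 ∧ ∀ s ∈ Set.Ioo (0 : ℝ) 1, tau0 t ≤ tau0 s := by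
  refine ⟨strictConvexOn_tau0.convexOn, ?_, ?_, ?_⟩
  · rw [tau0_eq_inv_mul_tau0Modulus]
    refine tendsto_inv_nhdsGT_zero.comp
      (tendsto_nhdsWithin_iff.2 ⟨tendsto_mul_tau0Modulus_zero, ?_⟩)
    filter_upwards [self_mem_nhdsWithin] with t ht using mul_pos ht.1 (tau0Modulus_pos ht)
  · rw [tau0_eq_inv_mul_tau0Modulus]
    simpa using tendsto_mul_tau0Modulus_one.inv₀ one_ne_zero
  · obtain ⟨t, ht, hmax⟩ := exists_forall_mul_tau0Modulus_le
    have hmin : ∀ s ∈ Ioo (0 : ℝ) 1, tau0 t ≤ tau0 s := fun s hs => by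
      rw [tau0_eq_inv_mul_tau0Modulus]
      exact inv_anti₀ (mul_pos hs.1 (tau0Modulus_pos hs)) (hmax s hs)
    exact ⟨t, ⟨ht, hmin⟩, fun u hu => strictConvexOn_tau0.eq_of_isMinOn hu.2 hmin hu.1 ht⟩
end

section
/- For every real α and every x > 0, g(x) − α·ρ(x) = ∫₀^∞ e^{−tx} F_α(t) dt, where F_α(t) = e^{−t} + ∫₀¹ e^{−ts} τ₀(s) ds − α·((1 − e^{−t})/t − e^{−t}). -/
/-- `ρ(x) = log(1 + 1/x) − 1/(x+1)`. -/
noncomputable def rho (x : ℝ) : ℝ := Real.log (1 + 1 / x) - 1 / (x + 1)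

/-- `g = −ρ′/ρ`. -/
noncomputable def gfun (x : ℝ) : ℝ := -deriv rho x / rho x

/-- `F_α(t) = e^{−t} + ∫₀¹ e^{−ts} τ₀(s) ds − α·((1 − e^{−t})/t − e^{−t})`. -/
noncomputable def Ffun (α : ℝ) (t : ℝ) : ℝ :=
  Real.exp (-t) + (∫ s in (0 : ℝ)..1, Real.exp (-(t * s)) * tau0 s) -
    α * ((1 - Real.exp (-t)) / t - Real.exp (-t))

/-- The entire function `z - 1 + e^{-z}`. -/
noncomputable def phi (z : ℂ) : ℂ := z - 1 + Complex.exp (-z)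

/-- The quotient `(1 - e^z) (1 - e^{-z}) / phi z`, where `1 - e^{-z}` is the derivative of `phi`. -/
noncomputable def phiQuot (z : ℂ) : ℂ :=
  (1 - Complex.exp z) * (1 - Complex.exp (-z)) / phi z

/-- The closed horizontal strip `|Im z| ≤ π`. -/
def closedStrip : Set ℂ := {z | |z.im| ≤ Real.pi}

lemma mul_cos_lt_sin {b : ℝ} (h0 : 0 < b) (h1 : b < Real.pi) : b * Real.cos b < Real.sin b := by
  rcases lt_or_ge b (Real.pi / 2) with h | h
  · have hc : 0 < Real.cos b := Real.cos_pos_of_mem_Ioo ⟨by linarith, h⟩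
    have := Real.lt_tan h0 h
    rwa [Real.tan_eq_sin_div_cos, lt_div_iff₀ hc] at this
  · have hc : Real.cos b ≤ 0 := Real.cos_nonpos_of_pi_div_two_le_of_le h (by linarith)
    have hs : 0 < Real.sin b := Real.sin_pos_of_pos_of_lt_pi h0 h1
    nlinarith

lemma phi_re (z : ℂ) : (phi z).re = z.re - 1 + Real.exp (-z.re) * Real.cos z.im := by
  simp [phi, Complex.exp_re]

lemma phi_im (z : ℂ) : (phi z).im = z.im - Real.exp (-z.re) * Real.sin z.im := by
  simp [phi, Complex.exp_im, sub_eq_add_neg]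

lemma no_common_zero {a b : ℝ} (hb : 0 < b) (hb' : b ≤ Real.pi)
    (hr : a - 1 + Real.exp (-a) * Real.cos b = 0) (hi : b - Real.exp (-a) * Real.sin b = 0) :
    False := by
  have hlt : b < Real.pi := by
    refine lt_of_le_of_ne hb' fun h => ?_
    rw [h, Real.sin_pi] at hi
    linarith [Real.pi_pos]
  have hs : 0 < Real.sin b := Real.sin_pos_of_pos_of_lt_pi hb hlt
  have h1 := Real.sin_lt hb
  have h2 := mul_cos_lt_sin hb hlt
  have hE : 1 < Real.exp (-a) := by
    by_contra! h
    nlinarith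
  have ha : 0 < -a := Real.one_lt_exp_iff.mp hE
  have : (1 - a) * Real.sin b = b * Real.cos b := by
    linear_combination (-Real.sin b) * hr - Real.cos b * hi
  nlinarith

lemma phi_ne_zero {z : ℂ} (hz : z ∈ closedStrip) (h0 : z ≠ 0) : phi z ≠ 0 := by
  intro h
  have hr := phi_re z
  have hi := phi_im z
  rw [h] at hr hi
  simp only [Complex.zero_re, Complex.zero_im] at hr hi
  have hz' := abs_le.mp (show |z.im| ≤ Real.pi from hz)
  rcases lt_trichotomy z.im 0 with hb | hb | hb
  · exact no_common_zero (a := z.re) (b := -z.im) (by linarith) (by linarith)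
      (by rw [Real.cos_neg]; linarith) (by rw [Real.sin_neg]; linarith)
  · rw [hb, Real.cos_zero] at hr
    by_cases ha : z.re = 0
    · exact h0 (Complex.ext ha hb)
    · linarith [Real.add_one_lt_exp (neg_ne_zero.mpr ha)]
  · exact no_common_zero hb hz'.2 hr.symm hi.symm

lemma differentiable_dslope {f : ℂ → ℂ} (hf : Differentiable ℂ f) (a : ℂ) :
    Differentiable ℂ (dslope f a) := by
  rw [← differentiableOn_univ, Complex.differentiableOn_dslope Filter.univ_mem]
  exact hf.differentiableOn

lemma differentiable_phi : Differentiable ℂ phi := by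
  unfold phi; fun_prop

lemma hasDerivAt_phi (z : ℂ) : HasDerivAt phi (1 - Complex.exp (-z)) z := by
  have h : HasDerivAt (fun z : ℂ => Complex.exp (-z)) (Complex.exp (-z) * -1) z :=
    (hasDerivAt_neg z).cexp
  exact (((hasDerivAt_id z).sub_const 1).add h).congr_deriv (by ring)

lemma exists_phi_eq_sq_mul :
    ∃ q : ℂ → ℂ, Differentiable ℂ q ∧ q 0 ≠ 0 ∧ ∀ z, phi z = z ^ 2 * q z := by
  have hp := differentiable_dslope differentiable_phi 0
  have h0 : phi 0 = 0 := by simp [phi]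
  have hp0 : dslope phi 0 0 = 0 := by
    rw [dslope_same, (hasDerivAt_phi 0).deriv]; simp
  have hphi : ∀ z, phi z = z * dslope phi 0 z := fun z => by
    have := sub_smul_dslope phi 0 z
    simpa [h0] using this.symm
  set p := dslope phi 0
  refine ⟨dslope p 0, differentiable_dslope hp 0, ?_, fun z => ?_⟩
  · rw [dslope_same]
    have hfun : (fun z : ℂ => 1 - Complex.exp (-z)) = fun z => p z + z * deriv p z := by
      funext z
      have h1 : HasDerivAt (fun z => z * p z) (1 * p z + z * deriv p z) z :=
        (hasDerivAt_id z).mul (hp z).hasDerivAt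
      rw [← funext hphi] at h1
      rw [(hasDerivAt_phi z).unique h1, one_mul]
    have hp' : Differentiable ℂ (deriv p) := by
      rw [← differentiableOn_univ]
      exact hp.differentiableOn.deriv isOpen_univ
    have h2 : HasDerivAt (fun z => p z + z * deriv p z)
        (deriv p 0 + (1 * deriv p 0 + 0 * deriv (deriv p) 0)) 0 :=
      (hp 0).hasDerivAt.add ((hasDerivAt_id (0 : ℂ)).mul (hp' 0).hasDerivAt)
    have h3 : HasDerivAt (fun z : ℂ => 1 - Complex.exp (-z)) 1 0 := by
      exact ((hasDerivAt_neg (0 : ℂ)).cexp.const_sub 1).congr_deriv (by simp)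
    rw [hfun] at h3
    intro h
    have := h3.unique h2
    simp [h] at this
  · have := sub_smul_dslope p 0 z
    simp only [sub_zero, smul_eq_mul, hp0] at this
    rw [hphi, ← this]; ring

/-- The function `(e^z - 1) / z`, extended to the origin. -/
noncomputable def expSlope : ℂ → ℂ := dslope Complex.exp 0

lemma differentiable_expSlope : Differentiable ℂ expSlope :=
  differentiable_dslope Complex.differentiable_exp 0

lemma mul_expSlope (z : ℂ) : z * expSlope z = Complex.exp z - 1 := by
  simpa [expSlope] using sub_smul_dslope Complex.exp 0 z

lemma expSlope_ne_zero {z : ℂ} (hz : z ∈ closedStrip) : expSlope z ≠ 0 := by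
  by_cases h0 : z = 0
  · simp [h0, expSlope]
  intro h
  have h1 := mul_expSlope z
  rw [h, mul_zero, eq_comm, sub_eq_zero, Complex.exp_eq_one_iff] at h1
  obtain ⟨n, hn⟩ := h1
  have him : z.im = n * (2 * Real.pi) := by rw [hn]; simp
  have hz' : |z.im| ≤ Real.pi := hz
  rw [him, abs_mul, abs_of_pos Real.two_pi_pos] at hz'
  have hn0 : n ≠ 0 := by
    rintro rfl
    simp at hn
    exact h0 hn
  have : (1 : ℝ) ≤ |(n : ℝ)| := by exact_mod_cast Int.one_le_abs hn0
  nlinarith [Real.pi_pos]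

lemma exists_differentiableOn_phiQuot :
    ∃ N : ℂ → ℂ, DifferentiableOn ℂ N closedStrip ∧ ∀ z ≠ 0, N z = phiQuot z := by
  obtain ⟨q, hq, hq0, hphi⟩ := exists_phi_eq_sq_mul
  refine ⟨fun z => -Complex.exp (-z) * expSlope z ^ 2 / q z, ?_, fun z hz => ?_⟩
  · refine DifferentiableOn.div ?_ hq.differentiableOn fun z hz => ?_
    · have := differentiable_expSlope
      exact Differentiable.differentiableOn (by fun_prop)
    · by_cases h0 : z = 0
      · rwa [h0]
      · have := phi_ne_zero hz h0
        rw [hphi] at this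
        exact right_ne_zero_of_mul this
  · have h1 : (1 - Complex.exp z) * (1 - Complex.exp (-z))
        = z ^ 2 * (-Complex.exp (-z) * expSlope z ^ 2) := by
      have h2 : Complex.exp z * Complex.exp (-z) = 1 := by rw [← Complex.exp_add]; simp
      have h3 : Complex.exp z = 1 + z * expSlope z := by rw [mul_expSlope]; ring
      have h4 : z ^ 2 * (-Complex.exp (-z) * expSlope z ^ 2)
          = -Complex.exp (-z) * (z * expSlope z) ^ 2 := by ring
      rw [h4, mul_expSlope]
      linear_combination (Complex.exp z - 1) * h2
    rw [phiQuot, h1, hphi, mul_div_mul_left _ _ (pow_ne_zero 2 hz)]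

/-- The kernel integrated along the boundary of the strip; `c` cancels the pole on the real axis. -/
noncomputable def stripKernel (x : ℝ) (c z : ℂ) : ℂ :=
  (phiQuot z - c) / (x + 1 - x * Complex.exp z)

lemma exists_differentiableOn_stripKernel {x a : ℝ} (hx : 0 < x) (ha : a ≠ 0)
    (hax : x * Real.exp a = x + 1) :
    ∃ H : ℂ → ℂ, DifferentiableOn ℂ H closedStrip ∧
      ∀ z : ℂ, z ≠ 0 → z ≠ a → H z = stripKernel x (phiQuot a) z := by
  obtain ⟨N, hN, hNq⟩ := exists_differentiableOn_phiQuot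
  have hnhds : closedStrip ∈ nhds (a : ℂ) := by
    have : IsOpen {z : ℂ | |z.im| < Real.pi} :=
      isOpen_lt (by fun_prop) continuous_const
    refine Filter.mem_of_superset (this.mem_nhds ?_) fun z (hz : |z.im| < Real.pi) => hz.le
    simp [Real.pi_pos]
  have hmem : ∀ z ∈ closedStrip, z - a ∈ closedStrip := fun z hz => by
    simpa [closedStrip] using hz
  have hx1 : (x : ℂ) + 1 ≠ 0 := by exact_mod_cast (by linarith : x + 1 ≠ 0)
  refine ⟨fun z => -dslope N a z / ((x + 1) * expSlope (z - a)), ?_, fun z hz hza => ?_⟩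
  · refine DifferentiableOn.div ?_ ?_ fun z hz => ?_
    · exact ((Complex.differentiableOn_dslope hnhds).mpr hN).neg
    · have := differentiable_expSlope
      exact Differentiable.differentiableOn (by fun_prop)
    · exact mul_ne_zero hx1 (expSlope_ne_zero (hmem z hz))
  · have hza' : z - a ≠ 0 := sub_ne_zero.mpr hza
    have h1 : phiQuot z - phiQuot a = (z - a) * dslope N a z := by
      rw [← hNq z hz, ← hNq a (by exact_mod_cast ha), ← smul_eq_mul, sub_smul_dslope]
    have h2 : (x : ℂ) + 1 - x * Complex.exp z = (z - a) * -((x + 1) * expSlope (z - a)) := by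
      have h3 : (x : ℂ) * Complex.exp a = x + 1 := by exact_mod_cast congrArg Complex.ofReal hax
      have h4 : Complex.exp z = Complex.exp (z - a) * Complex.exp a := by
        rw [← Complex.exp_add]; ring_nf
      have h5 := mul_expSlope (z - a)
      rw [h4]
      linear_combination (-(x + 1 : ℂ)) * (-h5) - Complex.exp (z - a) * h3
    simp only [stripKernel]
    rw [h1, h2, mul_div_mul_left _ _ hza', div_neg, neg_div]

open Filter Topology

/-- The jump of the kernel across the strip, divided by `2πi`. -/
noncomputable def jump (x u : ℝ) : ℝ :=
  (1 + Real.exp u) * (1 + Real.exp (-u)) /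
    (((u - 1 - Real.exp (-u)) ^ 2 + Real.pi ^ 2) * (x + 1 + x * Real.exp u))

lemma tendsto_comap_re_atTop_stripKernel {x : ℝ} (hx : 0 < x) (c : ℂ) :
    Tendsto (stripKernel x c) (comap Complex.re atTop) (𝓝 0) := by
  have hre : Tendsto Complex.re (comap Complex.re atTop) atTop := tendsto_comap
  have hE : Tendsto (fun z : ℂ => Complex.exp (-z)) (comap Complex.re atTop) (𝓝 0) := by
    refine Complex.tendsto_exp_comap_re_atBot.comp (tendsto_comap_iff.mpr ?_)
    exact tendsto_neg_atTop_atBot.comp hre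
  have hphi : Tendsto (fun z => (phi z)⁻¹) (comap Complex.re atTop) (𝓝 0) := by
    refine tendsto_inv₀_cobounded.comp (tendsto_norm_atTop_iff_cobounded.mp ?_)
    refine tendsto_atTop_mono (fun z => Complex.re_le_norm (phi z)) ?_
    have h1 : Tendsto (fun z : ℂ => z.re + (-1 + (Complex.exp (-z)).re))
        (comap Complex.re atTop) atTop :=
      hre.atTop_add (((Complex.continuous_re.tendsto _).comp hE).const_add (-1))
    refine h1.congr fun z => ?_
    simp only [phi, Complex.add_re, Complex.sub_re, Complex.one_re]
    ring
  have hx0 : (x : ℂ) ≠ 0 := by exact_mod_cast hx.ne'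
  have hlim : Tendsto (fun z : ℂ => ((Complex.exp (-z) - 1) * (1 - Complex.exp (-z)) * (phi z)⁻¹
      - c * Complex.exp (-z)) / ((x + 1) * Complex.exp (-z) - x)) (comap Complex.re atTop)
      (𝓝 (((0 - 1) * (1 - 0) * 0 - c * 0) / ((x + 1) * 0 - x))) :=
    ((((hE.sub_const 1).mul (hE.const_sub 1)).mul hphi).sub (hE.const_mul c)).div
      ((hE.const_mul _).sub_const _) (by simpa using hx0)
  simp only [mul_zero, sub_zero, zero_div] at hlim
  refine hlim.congr fun z => ?_
  have hz : Complex.exp (-z) ≠ 0 := Complex.exp_ne_zero _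
  have h1 : Complex.exp z * Complex.exp (-z) = 1 := by rw [← Complex.exp_add]; simp
  rw [stripKernel, phiQuot, ← mul_div_mul_right _ (x + 1 - x * Complex.exp z) hz]
  congr 1
  · rw [div_eq_mul_inv]
    linear_combination (1 - Complex.exp (-z)) * (phi z)⁻¹ * h1
  · linear_combination x * h1

lemma tendsto_comap_re_atBot_stripKernel {x : ℝ} (hx : 0 < x) (c : ℂ) :
    Tendsto (stripKernel x c) (comap Complex.re atBot ⊓ 𝓟 closedStrip)
      (𝓝 ((-1 - c) / (x + 1))) := by
  have hE : Tendsto Complex.exp (comap Complex.re atBot ⊓ 𝓟 closedStrip) (𝓝 0) :=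
    Complex.tendsto_exp_comap_re_atBot.mono_left inf_le_left
  have hre : Tendsto Complex.re (comap Complex.re atBot ⊓ 𝓟 closedStrip) atBot :=
    tendsto_comap.mono_left inf_le_left
  have hzE : Tendsto (fun z => z * Complex.exp z) (comap Complex.re atBot ⊓ 𝓟 closedStrip)
      (𝓝 0) := by
    have h1 : Tendsto (fun t : ℝ => (-t) ^ 1 * Real.exp (- -t) + Real.pi * Real.exp t) atBot
        (𝓝 (0 + Real.pi * 0)) :=
      ((Real.tendsto_pow_mul_exp_neg_atTop_nhds_zero 1).comp tendsto_neg_atBot_atTop).add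
        (Real.tendsto_exp_atBot.const_mul _)
    simp only [mul_zero, add_zero] at h1
    refine squeeze_zero_norm' ?_ (h1.comp hre)
    filter_upwards [hre.eventually (eventually_le_atBot 0),
      (eventually_principal.mpr fun z hz => hz :
        ∀ᶠ z in 𝓟 closedStrip, z ∈ closedStrip).filter_mono inf_le_right] with z hz hz'
    have h2 := Complex.norm_le_abs_re_add_abs_im z
    have h3 : |z.im| ≤ Real.pi := hz'
    rw [abs_of_nonpos hz] at h2
    rw [norm_mul, Complex.norm_exp]
    simp only [Function.comp_apply, pow_one, neg_neg, ← add_mul]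
    gcongr
    linarith
  have hx1 : (x : ℂ) + 1 ≠ 0 := by exact_mod_cast (by linarith : x + 1 ≠ 0)
  have hlim : Tendsto (fun z : ℂ => ((1 - Complex.exp z) * (Complex.exp z - 1) /
      (1 + (z * Complex.exp z - Complex.exp z)) - c) / (x + 1 - x * Complex.exp z))
      (comap Complex.re atBot ⊓ 𝓟 closedStrip)
      (𝓝 (((1 - 0) * (0 - 1) / (1 + (0 - 0)) - c) / (x + 1 - x * 0))) :=
    ((((hE.const_sub 1).mul (hE.sub_const 1)).div ((hzE.sub hE).const_add 1)
      (by simp)).sub_const c).div ((hE.const_mul _).const_sub _) (by simpa using hx1)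
  convert hlim.congr fun z => ?_ using 2
  · simp
  have hz : Complex.exp z ≠ 0 := Complex.exp_ne_zero _
  have h1 : Complex.exp z * Complex.exp (-z) = 1 := by rw [← Complex.exp_add]; simp
  rw [stripKernel, phiQuot, ← mul_div_mul_right _ (phi z) hz, phi]
  congr 3
  · linear_combination (1 - Complex.exp z) * h1
  · linear_combination -h1

lemma tendsto_integral_vertical {H : ℂ → ℂ} (hH : ContinuousOn H closedStrip) {l : Filter ℝ}
    [l.IsCountablyGenerated] {L : ℂ}
    (h : Tendsto H (comap Complex.re l ⊓ 𝓟 closedStrip) (𝓝 L)) :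
    Tendsto (fun R : ℝ => ∫ y in (-Real.pi)..Real.pi, H (R + y * Complex.I)) l
      (𝓝 (2 * Real.pi * L)) := by
  have hmem : ∀ R : ℝ, ∀ y ∈ Set.uIcc (-Real.pi) Real.pi,
      (R + y * Complex.I : ℂ) ∈ closedStrip := fun R y hy => by
    rw [Set.uIcc_of_le (by linarith [Real.pi_pos])] at hy
    simpa [closedStrip] using abs_le.mpr hy
  have key := TendstoUniformlyOn.tendsto_intervalIntegral_of_continuousOn
    (μ := MeasureTheory.volume) (l := l) (F := fun R y : ℝ => H (R + y * Complex.I))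
    (f := fun _ => L) (a := -Real.pi) (b := Real.pi)
    (Eventually.of_forall fun R => hH.comp (by fun_prop) (hmem R)) ?_
  · convert key using 2
    rw [intervalIntegral.integral_const, Complex.real_smul]
    push_cast
    ring
  · rw [← tendsto_prod_principal_iff]
    refine h.comp (tendsto_inf.mpr ⟨tendsto_comap_iff.mpr ?_, tendsto_principal.mpr ?_⟩)
    · refine tendsto_fst.congr fun p => ?_
      simp
    · refine (eventually_principal.mpr fun y hy => hy : ∀ᶠ y in 𝓟 (Set.uIcc (-Real.pi) Real.pi),
        y ∈ Set.uIcc (-Real.pi) Real.pi).prod_inr l |>.mono fun p hp => hmem p.1 p.2 hp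

lemma stripKernel_sub_stripKernel {x : ℝ} (hx : 0 < x) (c : ℂ) (u : ℝ) :
    stripKernel x c (u + (-Real.pi : ℝ) * Complex.I) - stripKernel x c (u + Real.pi * Complex.I)
      = 2 * Real.pi * Complex.I * jump x u := by
  have e1 : Complex.exp (u + (-Real.pi : ℝ) * Complex.I) = -(Real.exp u : ℝ) := by
    rw [Complex.exp_add]; simp [Complex.exp_neg]
  have e2 : Complex.exp (u + Real.pi * Complex.I) = -(Real.exp u : ℝ) := by
    rw [Complex.exp_add]; simp
  have e3 : Complex.exp (-(u + (-Real.pi : ℝ) * Complex.I)) = -(Real.exp (-u) : ℝ) := by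
    rw [neg_add, Complex.exp_add]; simp
  have e4 : Complex.exp (-(u + Real.pi * Complex.I)) = -(Real.exp (-u) : ℝ) := by
    rw [neg_add, Complex.exp_add]; simp [Complex.exp_neg]
  simp only [stripKernel, phiQuot, phi, jump, e1, e2, e3, e4]
  have hA : (x : ℂ) + 1 + x * (Real.exp u : ℝ) ≠ 0 := by
    exact_mod_cast (by positivity : x + 1 + x * Real.exp u ≠ 0)
  set v : ℝ := u - 1 - Real.exp (-u) with hv
  have hp : (v : ℂ) + Real.pi * Complex.I ≠ 0 := fun h => by
    have := congrArg Complex.im h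
    simp [Real.pi_ne_zero] at this
  have hm : (v : ℂ) - Real.pi * Complex.I ≠ 0 := fun h => by
    have := congrArg Complex.im h
    simp [Real.pi_ne_zero] at this
  have hvm : (u : ℂ) + (-Real.pi : ℝ) * Complex.I - 1 + -(Real.exp (-u) : ℝ)
      = v - Real.pi * Complex.I := by
    rw [hv]; push_cast; ring
  have hvp : (u : ℂ) + Real.pi * Complex.I - 1 + -(Real.exp (-u) : ℝ)
      = v + Real.pi * Complex.I := by
    rw [hv]; push_cast; ring
  rw [hvm, hvp]
  have hprod : (((v ^ 2 + Real.pi ^ 2 : ℝ)) : ℂ)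
      = (v + Real.pi * Complex.I) * (v - Real.pi * Complex.I) := by
    push_cast
    linear_combination (Real.pi : ℂ) ^ 2 * Complex.I_sq
  rw [Complex.ofReal_div, Complex.ofReal_mul _ (x + 1 + x * Real.exp u), hprod]
  push_cast at hA ⊢
  rw [mul_neg, sub_neg_eq_add]
  field_simp
  ring

lemma continuous_jump {x : ℝ} (hx : 0 < x) : Continuous (jump x) := by
  unfold jump
  refine Continuous.div (by fun_prop) (by fun_prop) fun u => ?_
  have := Real.pi_pos
  positivity

lemma jump_nonneg {x : ℝ} (hx : 0 < x) (u : ℝ) : 0 ≤ jump x u := by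
  unfold jump; positivity

lemma tendsto_integral_jump {x a : ℝ} (hx : 0 < x) (ha : 0 < a)
    (hax : x * Real.exp a = x + 1) {c : ℝ} (hc : phiQuot a = c) :
    Tendsto (fun R : ℝ => ∫ u in (-R)..R, jump x u) atTop (𝓝 ((-1 - c) / (x + 1))) := by
  obtain ⟨H, hH, hHk⟩ := exists_differentiableOn_stripKernel hx ha.ne' hax
  rw [hc] at hHk
  have hpi := Real.pi_pos
  have htop : Tendsto H (comap Complex.re atTop ⊓ 𝓟 closedStrip) (𝓝 0) := by
    refine ((tendsto_comap_re_atTop_stripKernel hx c).congr' ?_).mono_left inf_le_left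
    filter_upwards [tendsto_comap.eventually (eventually_gt_atTop a)] with z hz
    refine (hHk z ?_ ?_).symm
    · rintro rfl; simp at hz; linarith
    · rintro rfl; simp at hz
  have hbot : Tendsto H (comap Complex.re atBot ⊓ 𝓟 closedStrip) (𝓝 ((-1 - c) / (x + 1))) := by
    refine (tendsto_comap_re_atBot_stripKernel hx c).congr' ?_
    refine Eventually.filter_mono inf_le_left ?_
    filter_upwards [tendsto_comap.eventually (eventually_lt_atBot 0)] with z hz
    refine (hHk z ?_ ?_).symm
    · rintro rfl; simp at hz
    · rintro rfl; simp at hz; linarith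
  have hV := ((tendsto_integral_vertical hH.continuousOn hbot).comp tendsto_neg_atTop_atBot).sub
    (tendsto_integral_vertical hH.continuousOn htop)
  have hRect : ∀ R : ℝ, 0 < R → (2 * Real.pi * ((∫ u in (-R)..R, jump x u : ℝ) : ℂ))
      = (∫ y in (-Real.pi)..Real.pi, H ((-R : ℝ) + y * Complex.I))
        - ∫ y in (-Real.pi)..Real.pi, H (R + y * Complex.I) := by
    intro R hR
    have hrect := Complex.integral_boundary_rect_eq_zero_of_differentiableOn H
      ((-R : ℝ) + (-Real.pi : ℝ) * Complex.I) (R + Real.pi * Complex.I) (hH.mono ?_)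
    · simp only [Complex.add_re, Complex.add_im, Complex.ofReal_re, Complex.ofReal_im,
        Complex.mul_re, Complex.mul_im, Complex.I_re, Complex.I_im, mul_zero, mul_one,
        zero_add, add_zero, sub_self] at hrect
      rw [← intervalIntegral.integral_sub] at hrect
      · have hne : ∀ u b : ℝ, b ≠ 0 → ∀ t : ℝ, (u + b * Complex.I : ℂ) ≠ t := fun u b hb t h => by
          have := congrArg Complex.im h
          simp [hb] at this
        have hint : ∀ u : ℝ, H (u + (-Real.pi : ℝ) * Complex.I) - H (u + Real.pi * Complex.I)
            = 2 * Real.pi * Complex.I * jump x u := fun u => by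
          rw [hHk _ (by simpa using hne u _ (neg_ne_zero.mpr hpi.ne') 0)
              (hne u _ (neg_ne_zero.mpr hpi.ne') a),
            hHk _ (by simpa using hne u _ hpi.ne' 0) (hne u _ hpi.ne' a),
            stripKernel_sub_stripKernel hx]
        simp only [hint, intervalIntegral.integral_const_mul, smul_eq_mul,
          intervalIntegral.integral_ofReal] at hrect
        have hI : Complex.I ≠ 0 := Complex.I_ne_zero
        apply mul_left_cancel₀ hI
        linear_combination hrect
      all_goals
        refine ContinuousOn.intervalIntegrable (hH.continuousOn.comp (by fun_prop) fun u _ => ?_)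
        simp [closedStrip, abs_of_pos hpi]
    · rintro z ⟨-, hz⟩
      simp only [Complex.add_im, Complex.ofReal_im, Complex.mul_im, Complex.ofReal_re,
        Complex.I_im, Complex.I_re, mul_one, mul_zero, add_zero, zero_add] at hz
      rw [Set.mem_preimage, Set.uIcc_of_le (by linarith)] at hz
      exact abs_le.mpr hz
  have h2pi : (2 * Real.pi : ℂ) ≠ 0 := by exact_mod_cast (by positivity : 2 * Real.pi ≠ 0)
  have hC : Tendsto (fun R : ℝ => ((∫ u in (-R)..R, jump x u : ℝ) : ℂ)) atTop
      (𝓝 (((-1 - c) / (x + 1) : ℝ) : ℂ)) := by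
    have := hV.const_mul (2 * Real.pi : ℂ)⁻¹
    refine Tendsto.congr' ?_ (this.trans_eq ?_)
    · filter_upwards [eventually_gt_atTop 0] with R hR
      rw [Function.comp_apply, ← hRect R hR, inv_mul_cancel_left₀ h2pi]
    · rw [mul_zero, sub_zero, inv_mul_cancel_left₀ h2pi]
      push_cast
      rfl
  exact (Complex.continuous_re.tendsto _).comp hC

open MeasureTheory Set

lemma hasDerivAt_rho {x : ℝ} (hx : 0 < x) : HasDerivAt rho (-(1 / (x * (x + 1) ^ 2))) x := by
  have h1 : HasDerivAt (fun y : ℝ => 1 + 1 / y) (-(x ^ 2)⁻¹) x := by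
    simpa using (hasDerivAt_inv hx.ne').const_add 1
  have h2 : HasDerivAt (fun y : ℝ => 1 / (y + 1)) (-1 / (x + 1) ^ 2) x := by
    simpa only [one_div, id] using HasDerivAt.fun_inv ((hasDerivAt_id x).add_const 1)
      (by simpa using (by linarith : x + 1 ≠ 0))
  refine (HasDerivAt.fun_sub (h1.log (by positivity)) h2).congr_deriv ?_
  field_simp
  ring

lemma gfun_eq {x : ℝ} (hx : 0 < x) : gfun x = 1 / (x * (x + 1) ^ 2) / rho x := by
  rw [gfun, (hasDerivAt_rho hx).deriv, neg_neg]

lemma exp_log_one_add_one_div {x : ℝ} (hx : 0 < x) :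
    Real.exp (Real.log (1 + 1 / x)) = (x + 1) / x := by
  rw [Real.exp_log (by positivity)]
  field_simp

lemma phiQuot_log_one_add_one_div {x : ℝ} (hx : 0 < x) :
    phiQuot (Real.log (1 + 1 / x) : ℝ) = (-(x + 1) * gfun x : ℝ) := by
  have h : phiQuot (Real.log (1 + 1 / x) : ℝ) = (((1 - Real.exp (Real.log (1 + 1 / x))) *
      (1 - Real.exp (-Real.log (1 + 1 / x))) /
      (Real.log (1 + 1 / x) - 1 + Real.exp (-Real.log (1 + 1 / x))) : ℝ) : ℂ) := by
    simp only [phiQuot, phi]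
    push_cast
    rfl
  have hr : Real.log (1 + 1 / x) - 1 + x / (x + 1) = rho x := by
    rw [rho]
    field_simp
    ring
  rw [h, Real.exp_neg, exp_log_one_add_one_div hx, inv_div, hr, gfun_eq hx, ← mul_div_assoc]
  congr 2
  field_simp
  ring

lemma tendsto_integral_jump_gfun {x : ℝ} (hx : 0 < x) :
    Tendsto (fun R : ℝ => ∫ u in (-R)..R, jump x u) atTop (𝓝 (gfun x - 1 / (x + 1))) := by
  have h := tendsto_integral_jump hx
    (Real.log_pos (by linarith [one_div_pos.mpr hx] : 1 < 1 + 1 / x))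
    (by rw [exp_log_one_add_one_div hx]; field_simp) (phiQuot_log_one_add_one_div hx)
  convert h using 2
  field_simp
  ring

lemma integrable_jump {x : ℝ} (hx : 0 < x) : Integrable (jump x) := by
  refine integrable_of_intervalIntegral_norm_tendsto (gfun x - 1 / (x + 1))
    (fun R : ℝ => (continuous_jump hx).integrableOn_Ioc) tendsto_neg_atTop_atBot tendsto_id ?_
  simpa only [Real.norm_of_nonneg (jump_nonneg hx _), id] using tendsto_integral_jump_gfun hx

lemma integral_jump {x : ℝ} (hx : 0 < x) : ∫ u, jump x u = gfun x - 1 / (x + 1) :=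
  tendsto_nhds_unique (intervalIntegral_tendsto_integral (integrable_jump hx)
    tendsto_neg_atTop_atBot tendsto_id) (tendsto_integral_jump_gfun hx)

lemma image_univ_inv_one_add_exp :
    (fun u : ℝ => (1 + Real.exp u)⁻¹) '' univ = Ioo 0 1 := by
  ext s
  constructor
  · rintro ⟨u, -, rfl⟩
    have := Real.exp_pos u
    exact ⟨by positivity, inv_lt_one_of_one_lt₀ (by linarith)⟩
  · rintro ⟨h0, h1⟩
    have h2 : 0 < (1 - s) / s := div_pos (by linarith) h0
    refine ⟨Real.log ((1 - s) / s), mem_univ _, ?_⟩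
    simp only [Real.exp_log h2]
    field_simp
    ring

lemma hasDerivAt_inv_one_add_exp (u : ℝ) :
    HasDerivAt (fun u : ℝ => (1 + Real.exp u)⁻¹) (-Real.exp u / (1 + Real.exp u) ^ 2) u :=
  ((Real.hasDerivAt_exp u).const_add 1).inv (by positivity)

lemma injective_inv_one_add_exp : Function.Injective fun u : ℝ => (1 + Real.exp u)⁻¹ :=
  fun u v h => by simpa using h

lemma abs_deriv_smul_tau0 {x : ℝ} (hx : 0 < x) (u : ℝ) :
    |-Real.exp u / (1 + Real.exp u) ^ 2| •
      (tau0 (1 + Real.exp u)⁻¹ / (x + (1 + Real.exp u)⁻¹)) = jump x u := by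
  have hE := Real.exp_pos u
  have hlog : Real.log ((1 - (1 + Real.exp u)⁻¹) / (1 + Real.exp u)⁻¹) = u := by
    rw [show (1 - (1 + Real.exp u)⁻¹) / (1 + Real.exp u)⁻¹ = Real.exp u by field_simp; ring,
      Real.log_exp]
  rw [tau0, hlog, jump, Real.exp_neg, neg_div, abs_neg, abs_of_nonneg (by positivity), smul_eq_mul]
  generalize Real.exp u = E at *
  have hpi := Real.pi_pos
  have h1 : 1 - (1 + E)⁻¹ = E / (1 + E) := by field_simp; ring
  have h2 : (1 + E)⁻¹ * (E / (1 + E) * u - 1) ^ 2 + Real.pi ^ 2 * (1 + E)⁻¹ * (E / (1 + E)) ^ 2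
      = E ^ 2 / (1 + E) ^ 3 * ((u - 1 - E⁻¹) ^ 2 + Real.pi ^ 2) := by
    field_simp
    ring
  have h3 : 0 < (u - 1 - E⁻¹) ^ 2 + Real.pi ^ 2 := by positivity
  have h4 : x + (1 + E)⁻¹ = (x + 1 + x * E) / (1 + E) := by field_simp; ring
  rw [h1, h2, h4]
  generalize (u - 1 - E⁻¹) ^ 2 + Real.pi ^ 2 = D at *
  field_simp
  ring

lemma integrableOn_tau0_div {x : ℝ} (hx : 0 < x) :
    IntegrableOn (fun s => tau0 s / (x + s)) (Ioo 0 1) := by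
  rw [← image_univ_inv_one_add_exp, integrableOn_image_iff_integrableOn_abs_deriv_smul
    MeasurableSet.univ (fun u _ => (hasDerivAt_inv_one_add_exp u).hasDerivWithinAt)
    injective_inv_one_add_exp.injOn]
  simp only [abs_deriv_smul_tau0 hx]
  exact (integrable_jump hx).integrableOn

lemma integral_tau0_div {x : ℝ} (hx : 0 < x) :
    ∫ s in Ioo 0 1, tau0 s / (x + s) = gfun x - 1 / (x + 1) := by
  rw [← image_univ_inv_one_add_exp, integral_image_eq_integral_abs_deriv_smul
    MeasurableSet.univ (fun u _ => (hasDerivAt_inv_one_add_exp u).hasDerivWithinAt)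
    injective_inv_one_add_exp.injOn]
  simp only [abs_deriv_smul_tau0 hx]
  rw [setIntegral_univ, integral_jump hx]

lemma tau0_nonneg {s : ℝ} (hs : 0 ≤ s) : 0 ≤ tau0 s := by
  unfold tau0; positivity

lemma measurable_tau0 : Measurable tau0 := by
  unfold tau0; fun_prop

lemma integrableOn_exp_neg_mul {b : ℝ} (hb : 0 < b) :
    IntegrableOn (fun t : ℝ => Real.exp (-(t * b))) (Ioi 0) := by
  simpa only [neg_mul, mul_comm b] using exp_neg_integrableOn_Ioi 0 hb

lemma integral_exp_neg_mul {b : ℝ} (hb : 0 < b) :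
    ∫ t in Ioi (0 : ℝ), Real.exp (-(t * b)) = 1 / b := by
  have := integral_exp_mul_Ioi (neg_neg_iff_pos.mpr hb) 0
  simpa [mul_comm b] using this

lemma laplace_laplace {f : ℝ → ℝ} (hf : Measurable f) (h0 : ∀ s ∈ Ioo (0 : ℝ) 1, 0 ≤ f s)
    {x : ℝ} (hx : 0 < x) (hi : IntegrableOn (fun s => f s / (x + s)) (Ioo 0 1)) :
    IntegrableOn (fun t => Real.exp (-(t * x)) * ∫ s in (0 : ℝ)..1, Real.exp (-(t * s)) * f s)
        (Ioi 0) ∧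
      ∫ t in Ioi (0 : ℝ), Real.exp (-(t * x)) * ∫ s in (0 : ℝ)..1, Real.exp (-(t * s)) * f s
        = ∫ s in Ioo 0 1, f s / (x + s) := by
  have hF : ∀ s t : ℝ, Real.exp (-(t * x)) * (Real.exp (-(t * s)) * f s)
      = Real.exp (-(t * (x + s))) * f s := fun s t => by
    rw [← mul_assoc, ← Real.exp_add]; ring_nf
  have hinner : ∀ s ∈ Ioo (0 : ℝ) 1,
      ∫ t in Ioi (0 : ℝ), Real.exp (-(t * (x + s))) * f s = f s / (x + s) := fun s hs => by
    rw [integral_mul_const, integral_exp_neg_mul (by linarith [hs.1])]; ring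
  have hprod : Integrable (Function.uncurry fun t s : ℝ => Real.exp (-(t * (x + s))) * f s)
      ((volume.restrict (Ioi 0)).prod (volume.restrict (Ioo 0 1))) := by
    rw [integrable_prod_iff' (by unfold Function.uncurry; fun_prop)]
    constructor
    · filter_upwards [ae_restrict_mem measurableSet_Ioo] with s hs
      have hxs : 0 < x + s := by linarith [hs.1]
      exact (integrableOn_exp_neg_mul hxs).mul_const (f s)
    · refine hi.congr ?_
      filter_upwards [ae_restrict_mem measurableSet_Ioo] with s hs
      rw [← hinner s hs]
      refine integral_congr_ae (Eventually.of_forall fun t => ?_)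
      exact (Real.norm_of_nonneg (mul_nonneg (Real.exp_pos _).le (h0 s hs))).symm
  simp only [intervalIntegral.integral_of_le zero_le_one, integral_Ioc_eq_integral_Ioo,
    ← integral_const_mul, hF]
  refine ⟨hprod.integral_prod_left, ?_⟩
  rw [integral_integral_swap hprod]
  exact setIntegral_congr_fun measurableSet_Ioo hinner

lemma integral_exp_neg_mul_zero_one {t : ℝ} (ht : t ≠ 0) :
    ∫ s in (0 : ℝ)..1, Real.exp (-(t * s)) * 1 = (1 - Real.exp (-t)) / t := by
  have h : ∀ s ∈ uIcc (0 : ℝ) 1,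
      HasDerivAt (fun s => -Real.exp (-(t * s)) / t) (Real.exp (-(t * s)) * 1) s := fun s _ => by
    have h1 : HasDerivAt (fun s => -(t * s)) (-(t * 1)) s := ((hasDerivAt_id s).const_mul t).fun_neg
    refine (h1.exp.fun_neg.div_const t).congr_deriv ?_
    field_simp
  rw [intervalIntegral.integral_eq_sub_of_hasDerivAt h (Continuous.intervalIntegrable
    (by fun_prop) _ _)]
  simp only [mul_one, mul_zero, neg_zero, Real.exp_zero]
  ring

lemma integral_one_div_add {x : ℝ} (hx : 0 < x) :
    ∫ s in Ioo (0 : ℝ) 1, 1 / (x + s) = Real.log (1 + 1 / x) := by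
  rw [← integral_Ioc_eq_integral_Ioo, ← intervalIntegral.integral_of_le zero_le_one,
    intervalIntegral.integral_comp_add_left (fun s => 1 / s),
    integral_one_div_of_pos (by linarith) (by linarith)]
  congr 1
  field_simp
  ring

lemma integrableOn_one_div_add {x : ℝ} (hx : 0 < x) :
    IntegrableOn (fun s : ℝ => 1 / (x + s)) (Ioo 0 1) := by
  refine (ContinuousOn.integrableOn_Icc (ContinuousOn.div (by fun_prop) (by fun_prop)
    fun s hs => ?_)).mono_set Ioo_subset_Icc_self
  linarith [hs.1]

/-- For every real `α` and `x > 0`, `g(x) − α·ρ(x) = ∫₀^∞ e^{−tx} F_α(t) dt`. -/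
theorem g_sub_alpha_rho_laplace (α : ℝ) (x : ℝ) (hx : 0 < x) :
    gfun x - α * rho x = ∫ t in Set.Ioi (0 : ℝ), Real.exp (-(t * x)) * Ffun α t := by
  obtain ⟨hTi, hT⟩ := laplace_laplace measurable_tau0 (fun s hs => tau0_nonneg hs.1.le) hx
    (integrableOn_tau0_div hx)
  obtain ⟨hDi, hD⟩ := laplace_laplace measurable_const (fun _ _ => zero_le_one) hx
    (integrableOn_one_div_add hx)
  have hx1 : 0 < x + 1 := by linarith
  have hEi := integrableOn_exp_neg_mul hx1
  have hsplit : EqOn (fun t => Real.exp (-(t * x)) * Ffun α t)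
      (fun t => (Real.exp (-(t * (x + 1))) +
        Real.exp (-(t * x)) * ∫ s in (0 : ℝ)..1, Real.exp (-(t * s)) * tau0 s) -
        α * ((Real.exp (-(t * x)) * ∫ s in (0 : ℝ)..1, Real.exp (-(t * s)) * 1) -
          Real.exp (-(t * (x + 1))))) (Ioi 0) := fun t ht => by
    have h : Real.exp (-(t * (x + 1))) = Real.exp (-(t * x)) * Real.exp (-t) := by
      rw [← Real.exp_add]; ring_nf
    simp only [Ffun, integral_exp_neg_mul_zero_one (ne_of_gt ht), h]
    ring
  have hsum : IntegrableOn (fun t => Real.exp (-(t * (x + 1))) +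
      Real.exp (-(t * x)) * ∫ s in (0 : ℝ)..1, Real.exp (-(t * s)) * tau0 s) (Ioi 0) :=
    Integrable.add hEi hTi
  have hdiff : IntegrableOn (fun t => α * ((Real.exp (-(t * x)) *
      ∫ s in (0 : ℝ)..1, Real.exp (-(t * s)) * 1) - Real.exp (-(t * (x + 1))))) (Ioi 0) :=
    (Integrable.sub hDi hEi).const_mul α
  rw [setIntegral_congr_fun measurableSet_Ioi hsplit, integral_sub hsum hdiff, integral_add hEi hTi,
    integral_const_mul, integral_sub hDi hEi, hT, hD, integral_exp_neg_mul hx1,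
    integral_tau0_div hx, integral_one_div_add hx, rho]
  ring
end

section
/- For every integer n ≥ 4, t_n > 2/(n+1), where t_n = ∫₀¹ sⁿ τ₀(1−s) ds and τ₀(t) = ( t[(1−t)log((1−t)/t) − 1]² + π² t (1−t)² )^{−1}. -/
/-- The moments `t_n = ∫₀¹ sⁿ τ₀(1−s) ds`. -/
noncomputable def tmom (n : ℕ) : ℝ := ∫ s in (0 : ℝ)..1, s ^ n * tau0 (1 - s)

open Set Filter Topology MeasureTheory intervalIntegral

/-- The mass that the density `s ↦ τ₀(1 - s)` gives to `(s, 1)`. -/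
noncomputable def tailMass (s : ℝ) : ℝ :=
  1 / 2 - Real.arctan ((Real.log s - Real.log (1 - s) - s⁻¹) / Real.pi) / Real.pi

lemma tau0_nonneg_s16 {t : ℝ} (ht : 0 ≤ t) : 0 ≤ tau0 t := by
  unfold tau0
  positivity

lemma hasDerivAt_tailMass {s : ℝ} (h0 : 0 < s) (h1 : s < 1) :
    HasDerivAt tailMass (-tau0 (1 - s)) s := by
  have h2 : 0 < 1 - s := sub_pos.2 h1
  have hlog : Real.log (s / (1 - s)) = Real.log s - Real.log (1 - s) :=
    Real.log_div h0.ne' h2.ne'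
  have hq : HasDerivAt (fun x : ℝ => (Real.log x - Real.log (1 - x) - x⁻¹) / Real.pi)
      ((s⁻¹ - (-1) / (1 - s) - (-(s ^ 2)⁻¹)) / Real.pi) s :=
    (((Real.hasDerivAt_log h0.ne').sub
      (((hasDerivAt_id s).const_sub 1).log h2.ne')).sub (hasDerivAt_inv h0.ne')).div_const _
  convert! (hq.arctan.div_const Real.pi).const_sub (1 / 2) using 1
  unfold tau0
  rw [sub_sub_cancel, hlog]
  generalize Real.log s - Real.log (1 - s) = L
  have hpi := Real.pi_pos
  have e : (1 - s) * (s * L - 1) ^ 2 + Real.pi ^ 2 * (1 - s) * s ^ 2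
      = (1 - s) * ((s * L - 1) ^ 2 + Real.pi ^ 2 * s ^ 2) := by ring
  have h3 : 0 < (s * L - 1) ^ 2 + Real.pi ^ 2 * s ^ 2 := by positivity
  have e2 : 1 + ((L - s⁻¹) / Real.pi) ^ 2
      = ((s * L - 1) ^ 2 + Real.pi ^ 2 * s ^ 2) / (Real.pi ^ 2 * s ^ 2) := by
    field_simp
    ring
  rw [e, e2]
  field_simp
  ring

lemma tendsto_tailMass_zero : Tendsto tailMass (𝓝[>] 0) (𝓝 1) := by
  have hlog : Tendsto (fun s : ℝ => Real.log (1 - s)) (𝓝[>] 0) (𝓝 0) := by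
    have : ContinuousAt (fun s : ℝ => Real.log (1 - s)) 0 :=
      ContinuousAt.log (by fun_prop) (by norm_num)
    simpa using this.tendsto.mono_left nhdsWithin_le_nhds
  have h1 : Tendsto (fun s : ℝ => Real.log s - Real.log (1 - s)) (𝓝[>] 0) atBot := by
    simpa [sub_eq_add_neg] using Real.tendsto_log_nhdsGT_zero.atBot_add hlog.neg
  have h2 : Tendsto (fun s : ℝ => Real.log s - Real.log (1 - s) - s⁻¹) (𝓝[>] 0) atBot := by
    simpa [sub_eq_add_neg] using
      h1.atBot_add_atBot (tendsto_neg_atTop_atBot.comp tendsto_inv_nhdsGT_zero)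
  have h3 := (Real.tendsto_arctan_atBot.mono_right nhdsWithin_le_nhds).comp
    (h2.atBot_div_const Real.pi_pos)
  have e : 1 / 2 - -(Real.pi / 2) / Real.pi = 1 := by
    field_simp
    norm_num
  exact e ▸ (h3.div_const Real.pi).const_sub (1 / 2)

lemma tendsto_tailMass_one : Tendsto tailMass (𝓝[<] 1) (𝓝 0) := by
  have hc : Tendsto (fun s : ℝ => Real.log s - s⁻¹) (𝓝[<] 1) (𝓝 (-1)) := by
    have : ContinuousAt (fun s : ℝ => Real.log s - s⁻¹) 1 :=
      (Real.continuousAt_log one_ne_zero).sub (continuousAt_inv₀ one_ne_zero)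
    simpa using this.tendsto.mono_left nhdsWithin_le_nhds
  have hsub : Tendsto (fun s : ℝ => 1 - s) (𝓝[<] 1) (𝓝[>] 0) := by
    refine tendsto_nhdsWithin_iff.2 ⟨?_, ?_⟩
    · have : ContinuousAt (fun s : ℝ => 1 - s) 1 := by fun_prop
      simpa using this.tendsto.mono_left nhdsWithin_le_nhds
    · filter_upwards [self_mem_nhdsWithin] with s hs using mem_Ioi.2 (sub_pos.2 hs)
  have h1 : Tendsto (fun s : ℝ => -Real.log (1 - s)) (𝓝[<] 1) atTop :=
    tendsto_neg_atBot_atTop.comp (Real.tendsto_log_nhdsGT_zero.comp hsub)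
  have h2 : Tendsto (fun s : ℝ => Real.log s - Real.log (1 - s) - s⁻¹) (𝓝[<] 1) atTop :=
    (hc.add_atTop h1).congr fun s => by ring
  have h3 := (Real.tendsto_arctan_atTop.mono_right nhdsWithin_le_nhds).comp
    (h2.atTop_div_const Real.pi_pos)
  have e : 1 / 2 - Real.pi / 2 / Real.pi = 0 := by
    field_simp
    norm_num
  exact e ▸ (h3.div_const Real.pi).const_sub (1 / 2)

lemma intervalIntegrable_tau0 : IntervalIntegrable (fun s => tau0 (1 - s)) volume 0 1 := by
  have hcont : ContinuousOn (extendFrom (Ioo 0 1) tailMass) (Icc 0 1) :=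
    continuousOn_Icc_extendFrom_Ioo
      (fun x hx => (hasDerivAt_tailMass hx.1 hx.2).continuousAt.continuousWithinAt)
      tendsto_tailMass_zero tendsto_tailMass_one
  have hderiv : ∀ x ∈ Ioo (0 : ℝ) 1,
      HasDerivAt (-extendFrom (Ioo 0 1) tailMass) (tau0 (1 - x)) x := by
    intro x hx
    have h := (hasDerivAt_tailMass hx.1 hx.2).neg
    rw [neg_neg] at h
    refine h.congr_of_eventuallyEq ?_
    filter_upwards [Ioo_mem_nhds hx.1 hx.2] with y hy
    simp only [Pi.neg_apply, neg_inj]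
    exact extendFrom_extends
      (fun x hx => (hasDerivAt_tailMass hx.1 hx.2).continuousAt.continuousWithinAt) y hy
  apply intervalIntegrable_deriv_of_nonneg (g := -extendFrom (Ioo 0 1) tailMass)
  · rw [uIcc_of_le zero_le_one]
    exact hcont.neg
  · simpa using hderiv
  · intro x hx
    rw [max_eq_right zero_le_one] at hx
    exact tau0_nonneg_s16 (sub_nonneg.2 hx.2.le)

lemma intervalIntegrable_tau0' {a b : ℝ} (ha : 0 ≤ a) (hab : a ≤ b) (hb : b ≤ 1) :
    IntervalIntegrable (fun s => tau0 (1 - s)) volume a b :=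
  intervalIntegrable_tau0.mono_set <| by
    rw [uIcc_of_le hab, uIcc_of_le zero_le_one]
    exact Icc_subset_Icc ha hb

lemma intervalIntegrable_pow_mul_tau0 (n : ℕ) {a b : ℝ} (ha : 0 ≤ a) (hab : a ≤ b) (hb : b ≤ 1) :
    IntervalIntegrable (fun s => s ^ n * tau0 (1 - s)) volume a b :=
  (intervalIntegrable_tau0' ha hab hb).continuousOn_mul (by fun_prop)

lemma integral_tau0 {a b : ℝ} (ha : 0 < a) (hab : a ≤ b) (hb : b < 1) :
    ∫ s in a..b, tau0 (1 - s) = tailMass a - tailMass b := by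
  rw [integral_eq_sub_of_hasDerivAt (f := -tailMass) (fun x hx => ?_)
    (intervalIntegrable_tau0' ha.le hab hb.le)]
  · simp only [Pi.neg_apply]
    ring
  · rw [uIcc_of_le hab] at hx
    simpa using (hasDerivAt_tailMass (ha.trans_le hx.1) (hx.2.trans_lt hb)).neg

lemma integral_tau0_one {a : ℝ} (ha : 0 < a) (h1 : a < 1) :
    ∫ s in a..1, tau0 (1 - s) = tailMass a := by
  have hderiv : ∀ x ∈ Ioo a 1, HasDerivAt (-tailMass) (tau0 (1 - x)) x := fun x hx => by
    simpa using (hasDerivAt_tailMass (ha.trans hx.1) hx.2).neg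
  rw [integral_eq_sub_of_hasDerivAt_of_tendsto h1 hderiv
    (intervalIntegrable_tau0' ha.le h1.le le_rfl)
    ((hasDerivAt_tailMass ha h1).neg.continuousAt.tendsto.mono_left nhdsWithin_le_nhds)
    tendsto_tailMass_one.neg]
  simp

lemma pow_mul_integral_tau0_le (n : ℕ) {a b : ℝ} (ha : 0 ≤ a) (hab : a ≤ b) (hb : b ≤ 1) :
    a ^ n * ∫ s in a..b, tau0 (1 - s) ≤ ∫ s in a..b, s ^ n * tau0 (1 - s) := by
  rw [← intervalIntegral.integral_const_mul]
  refine integral_mono_on hab ((intervalIntegrable_tau0' ha hab hb).const_mul _)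
    (intervalIntegrable_pow_mul_tau0 n ha hab hb) fun s hs => ?_
  exact mul_le_mul_of_nonneg_right (pow_le_pow_left₀ ha hs.1 n)
    (tau0_nonneg_s16 (sub_nonneg.2 (hs.2.trans hb)))

lemma pow_mul_tailMass_le (n : ℕ) {a : ℝ} (ha : 0 < a) (h1 : a < 1) :
    a ^ n * tailMass a ≤ ∫ s in a..1, s ^ n * tau0 (1 - s) := by
  simpa only [integral_tau0_one ha h1] using pow_mul_integral_tau0_le n ha.le h1.le le_rfl

lemma pow_mul_tailMass_sub_add_le (n : ℕ) {a b : ℝ} (ha : 0 < a) (hab : a ≤ b) (hb : b < 1) :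
    a ^ n * (tailMass a - tailMass b) + ∫ s in b..1, s ^ n * tau0 (1 - s)
      ≤ ∫ s in a..1, s ^ n * tau0 (1 - s) := by
  rw [← integral_add_adjacent_intervals (intervalIntegrable_pow_mul_tau0 n ha.le hab hb.le)
    (intervalIntegrable_pow_mul_tau0 n (ha.le.trans hab) hb.le le_rfl),
    ← integral_tau0 ha hab hb]
  gcongr
  exact pow_mul_integral_tau0_le n ha.le hab hb.le

lemma integral_le_tmom (n : ℕ) {a : ℝ} (ha : 0 ≤ a) (h1 : a ≤ 1) :
    ∫ s in a..1, s ^ n * tau0 (1 - s) ≤ tmom n := by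
  unfold tmom
  rw [← integral_add_adjacent_intervals (intervalIntegrable_pow_mul_tau0 n le_rfl ha h1)
    (intervalIntegrable_pow_mul_tau0 n ha h1 le_rfl)]
  refine le_add_of_nonneg_left (integral_nonneg ha fun s hs => ?_)
  exact mul_nonneg (pow_nonneg hs.1 n) (tau0_nonneg_s16 (sub_nonneg.2 (hs.2.trans h1)))

lemma div_le_arctan {x : ℝ} (hx : 0 ≤ x) : 3 * x / (3 + x ^ 2) ≤ Real.arctan x := by
  have hd : ∀ y : ℝ, HasDerivAt (fun y => Real.arctan y - 3 * y / (3 + y ^ 2))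
      (4 * y ^ 4 / ((1 + y ^ 2) * (3 + y ^ 2) ^ 2)) y := by
    intro y
    have h := (Real.hasDerivAt_arctan y).sub
      (((hasDerivAt_id y).const_mul 3).div ((hasDerivAt_pow 2 y).const_add 3)
        (by positivity : (3 : ℝ) + y ^ 2 ≠ 0))
    convert! h using 1
    simp only [id]
    field_simp
    norm_num
    ring
  have hm := monotone_of_hasDerivAt_nonneg hd fun y => by positivity
  have := hm hx
  simp only [Real.arctan_zero] at this
  norm_num at this
  linarith

lemma arctan_le_div {x : ℝ} (hx : 0 ≤ x) :
    Real.arctan x ≤ (15 * x + 4 * x ^ 3) / (15 + 9 * x ^ 2) := by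
  have hd : ∀ y : ℝ, HasDerivAt
      (fun y => (15 * y + 4 * y ^ 3) / (15 + 9 * y ^ 2) - Real.arctan y)
      (36 * y ^ 6 / ((1 + y ^ 2) * (15 + 9 * y ^ 2) ^ 2)) y := by
    intro y
    have h := ((((hasDerivAt_id y).const_mul 15).add ((hasDerivAt_pow 3 y).const_mul 4)).div
      (((hasDerivAt_pow 2 y).const_mul 9).const_add 15)
        (by positivity : (15 : ℝ) + 9 * y ^ 2 ≠ 0)).sub (Real.hasDerivAt_arctan y)
    convert! h using 1
    simp only [id]
    field_simp
    norm_num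
    ring
  have hm := monotone_of_hasDerivAt_nonneg hd fun y => by positivity
  have := hm hx
  simp only [Real.arctan_zero] at this
  norm_num at this
  linarith

lemma sub_arctan_le_tailMass {k z : ℝ} (hk : 0 < k) (h : Real.log k - 1 - k⁻¹ ≤ z * Real.pi) :
    1 / 2 - Real.arctan z / Real.pi ≤ tailMass (k / (k + 1)) := by
  have hk1 : 0 < k + 1 := by positivity
  have e : 1 - k / (k + 1) = 1 / (k + 1) := by
    field_simp
    ring
  have e2 : Real.log (k / (k + 1)) - Real.log (1 - k / (k + 1)) - (k / (k + 1))⁻¹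
      = Real.log k - 1 - k⁻¹ := by
    rw [e, Real.log_div hk.ne' hk1.ne', Real.log_div one_ne_zero hk1.ne', Real.log_one]
    field_simp
    ring
  unfold tailMass
  rw [e2]
  have hpi := Real.pi_pos
  gcongr
  rwa [div_le_iff₀ hpi]

lemma le_tailMass {k z r : ℝ} (hk : 0 < k) (hz : 0 ≤ z)
    (h : Real.log k - 1 - k⁻¹ ≤ z * 3.1415)
    (hr : (15 * z + 4 * z ^ 3) / (15 + 9 * z ^ 2) ≤ (1 / 2 - r) * 3.1415) :
    r ≤ tailMass (k / (k + 1)) := by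
  have hpi := Real.pi_gt_d4
  have h0 : 0 ≤ (15 * z + 4 * z ^ 3) / (15 + 9 * z ^ 2) := by positivity
  refine le_trans ?_ (sub_arctan_le_tailMass hk (h.trans (by gcongr)))
  have : Real.arctan z / Real.pi ≤ 1 / 2 - r := by
    rw [div_le_iff₀ Real.pi_pos]
    refine (arctan_le_div hz).trans (hr.trans ?_)
    have : 0 ≤ 1 / 2 - r := by linarith
    gcongr
  linarith

lemma tailMass_two : 0.577 ≤ tailMass (2 / (2 + 1)) := by
  have hlog := Real.log_two_lt_d9
  have hpi := Real.pi_lt_d4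
  refine le_trans ?_ (sub_arctan_le_tailMass (z := -0.256) two_pos (by norm_num; linarith))
  have h := div_le_arctan (x := 0.256) (by norm_num)
  have : 0.077 ≤ Real.arctan 0.256 / Real.pi := by
    rw [le_div_iff₀ Real.pi_pos]
    norm_num at h ⊢
    linarith
  rw [Real.arctan_neg, neg_div]
  linarith

lemma le_tailMass_two_pow (j : ℕ) {z r : ℝ} (hz : 0 ≤ z)
    (h : j * 0.6931471808 - 1 - (2 ^ j : ℝ)⁻¹ ≤ z * 3.1415)
    (hr : (15 * z + 4 * z ^ 3) / (15 + 9 * z ^ 2) ≤ (1 / 2 - r) * 3.1415) :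
    r ≤ tailMass (2 ^ j / (2 ^ j + 1)) := by
  refine le_tailMass (by positivity) hz (le_trans ?_ h) hr
  rw [Real.log_pow]
  gcongr
  exact Real.log_two_lt_d9.le

lemma tmom_gt_of_le_fifteen (n : ℕ) (hn : 4 ≤ n) (hn' : n ≤ 15) :
    2 / ((n : ℝ) + 1) < tmom n := by
  have p1 := tailMass_two
  have p2 := le_tailMass_two_pow 2 (z := 0.044) (r := 0.486)
    (by norm_num) (by norm_num) (by norm_num)
  have p3 := le_tailMass_two_pow 3 (z := 0.304) (r := 0.406)
    (by norm_num) (by norm_num) (by norm_num)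
  have p4 := le_tailMass_two_pow 4 (z := 0.545) (r := 0.341)
    (by norm_num) (by norm_num) (by norm_num)
  have p5 := le_tailMass_two_pow 5 (z := 0.775) (r := 0.289)
    (by norm_num) (by norm_num) (by norm_num)
  have p6 := le_tailMass_two_pow 6 (z := 1.001) (r := 0.247)
    (by norm_num) (by norm_num) (by norm_num)
  have h0 := integral_le_tmom n (a := 2 / 3) (by norm_num) (by norm_num)
  have h1 := pow_mul_tailMass_sub_add_le n (a := 2 / 3) (b := 4 / 5)
    (by norm_num) (by norm_num) (by norm_num)
  have h2 := pow_mul_tailMass_sub_add_le n (a := 4 / 5) (b := 8 / 9)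
    (by norm_num) (by norm_num) (by norm_num)
  have h3 := pow_mul_tailMass_sub_add_le n (a := 8 / 9) (b := 16 / 17)
    (by norm_num) (by norm_num) (by norm_num)
  have h4 := pow_mul_tailMass_sub_add_le n (a := 16 / 17) (b := 32 / 33)
    (by norm_num) (by norm_num) (by norm_num)
  have h5 := pow_mul_tailMass_sub_add_le n (a := 32 / 33) (b := 64 / 65)
    (by norm_num) (by norm_num) (by norm_num)
  have h6 := pow_mul_tailMass_le n (a := 64 / 65) (by norm_num) (by norm_num)
  norm_num at p1 p2 p3 p4 p5 p6
  have h := (add_le_add_right (add_le_add_right (add_le_add_right (add_le_add_right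
    (add_le_add_right h6 _ |>.trans h5) _ |>.trans h4) _ |>.trans h3) _ |>.trans h2) _
    |>.trans h1).trans h0
  clear h0 h1 h2 h3 h4 h5 h6
  refine lt_of_lt_of_le ?_ h
  interval_cases n <;> norm_num <;> linarith

lemma tmom_gt_of_sixteen_le (n : ℕ) (hn : 16 ≤ n) : 2 / ((n : ℝ) + 1) < tmom n := by
  have hn0 : (16 : ℝ) ≤ n := by exact_mod_cast hn
  have hpi := Real.pi_lt_d4
  have hpi0 := Real.pi_pos
  set k : ℝ := 4 * n - 1 with hk
  have hk0 : 0 < k := by linarith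
  have hlog : Real.log k ≤ n / 16 + 3.16 := by
    have h1 : Real.log k ≤ Real.log (2 ^ 6 * (n / 16)) :=
      Real.log_le_log hk0 (by linarith)
    have h2 : Real.log (n / 16) ≤ n / 16 - 1 := Real.log_le_sub_one_of_pos (by linarith)
    rw [Real.log_mul (by norm_num) (by positivity), Real.log_pow] at h1
    have := Real.log_two_lt_d9
    norm_num at h1 ⊢
    linarith
  set m : ℝ := n / 16 + 2.16 with hm
  have hm3 : 3 ≤ m := by
    norm_num at hm
    linarith
  have hP : 1 / (m + Real.pi) ≤ tailMass (k / (k + 1)) := by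
    refine le_trans ?_ (sub_arctan_le_tailMass (z := m / Real.pi) hk0 ?_)
    · have hy : 0 < m / Real.pi := by positivity
      have h1 : 1 / 2 - Real.arctan (m / Real.pi) / Real.pi
          = Real.arctan (m / Real.pi)⁻¹ / Real.pi := by
        rw [Real.arctan_inv_of_pos hy]
        field_simp
      have h2 := div_le_arctan (inv_nonneg.2 hy.le)
      rw [h1]
      refine le_trans ?_ (div_le_div_of_nonneg_right h2 hpi0.le)
      rw [inv_div, div_pow, le_div_iff₀ hpi0, div_mul_eq_mul_div, one_mul,
        div_le_div_iff₀ (by positivity) (by positivity)]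
      field_simp
      nlinarith
    · rw [div_mul_cancel₀ _ hpi0.ne']
      have : 0 < k⁻¹ := by positivity
      norm_num at hm hlog
      linarith
  have ha : k / (k + 1) = 1 + -(1 / (4 * n)) := by
    rw [hk]
    field_simp
    ring
  have hb : 3 / 4 ≤ (k / (k + 1)) ^ n := by
    rw [ha]
    have h4 : 1 / (4 * (n : ℝ)) ≤ 1 := by
      rw [div_le_one (by positivity)]
      linarith
    refine le_trans (le_of_eq ?_) (one_add_mul_le_pow (by linarith) n)
    field_simp
    norm_num
  have h1 : k / (k + 1) < 1 := by
    rw [div_lt_one (by positivity)]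
    linarith
  refine lt_of_lt_of_le ?_ (integral_le_tmom n (a := k / (k + 1)) (by positivity) h1.le)
  refine lt_of_lt_of_le ?_ (pow_mul_tailMass_le n (by positivity) h1)
  refine lt_of_lt_of_le ?_ (mul_le_mul hb hP (by positivity) (by positivity))
  rw [mul_one_div, div_lt_div_iff₀ (by positivity) (by positivity)]
  norm_num at hm hpi
  linarith

/-- For every `n ≥ 4`, `t_n > 2/(n+1)`. -/
theorem tmom_gt (n : ℕ) (hn : 4 ≤ n) : 2 / ((n : ℝ) + 1) < tmom n := by
  rcases le_total n 15 with h | h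
  · exact tmom_gt_of_le_fifteen n hn h
  · rcases h.eq_or_lt with rfl | h
    · exact tmom_gt_of_le_fifteen 15 hn le_rfl
    · exact tmom_gt_of_sixteen_le n h
end
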